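/- arXiv:2410.22667 — 8 statements merged into one kernel-verified Lean document; each statement's English description precedes it below -/
import Mathlib

section
/- Let p > 0 and let D, J, K be real numbers with D ≥ 0, J ≥ 0, K ≥ 1 and D ≤ K·J. Then D/log(e + D) ≤ (1/p)·(J + e^{pK} − 1). -/
/-- Pointwise Orlicz estimate: if D ≥ 0, J ≥ 0, K ≥ 1, D ≤ K·J and p > 0, then
D/log(e + D) ≤ (1/p)(J + e^{pK} − 1). -/
theorem stmt2 (p D J K : ℝ) (hp : 0 < p) (hD : 0 ≤ D) (hJ : 0 ≤ J) (hK : 1 ≤ K)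
    (hDKJ : D ≤ K * J) :
    D / Real.log (Real.exp 1 + D) ≤ (1 / p) * (J + Real.exp (p * K) - 1) := by
  set L := Real.log (Real.exp 1 + D)
  have hpos : 0 < Real.exp 1 + D := by positivity
  have hexpL : Real.exp L = Real.exp 1 + D := Real.exp_log hpos
  have hL1 : 1 ≤ L := (Real.le_log_iff_exp_le hpos).2 (by linarith)
  have hK0 : 0 < K := by linarith
  have hexp : 0 ≤ Real.exp (p * K) - 1 := by
    have := Real.one_le_exp (mul_pos hp hK0).le
    linarith
  suffices h : p * D ≤ L * (J + Real.exp (p * K) - 1) by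
    rw [div_le_iff₀ (by linarith), one_div, mul_assoc, inv_mul_eq_div, le_div_iff₀ hp]
    linarith
  obtain hle | hge := le_total (p * K) L
  · have h₁ : p * D ≤ p * K * J := by
      rw [mul_assoc]
      exact mul_le_mul_of_nonneg_left hDKJ hp.le
    have h₂ : p * K * J ≤ L * J := mul_le_mul_of_nonneg_right hle hJ
    have h₃ : 0 ≤ L * (Real.exp (p * K) - 1) := mul_nonneg (by linarith) hexp
    linarith
  · have hDJ : D / K ≤ J := (div_le_iff₀' hK0).2 hDKJ
    have hDD : D / K ≤ D := div_le_self hD hK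
    have hpD : p * D = p * K * (D / K) := by field_simp
    have h₁ : (p * K - L) * (D / K) ≤ (p * K - L) * D :=
      mul_le_mul_of_nonneg_left hDD (by linarith)
    have h₂ : (p * K - L) * D ≤ Real.exp (p * K) - 1 := by
      have hsplit : Real.exp (p * K) = Real.exp L * Real.exp (p * K - L) := by
        rw [← Real.exp_add]
        congr 1
        ring
      have htangent := mul_le_mul_of_nonneg_left (Real.add_one_le_exp (p * K - L))
        (Real.exp_pos L).le
      rw [← hsplit, hexpL] at htangent
      have hcross : 0 ≤ (p * K - L) * Real.exp 1 :=
        mul_nonneg (by linarith) (Real.exp_pos 1).le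
      have := Real.one_le_exp zero_le_one
      linarith
    have h₃ : Real.exp (p * K) - 1 ≤ L * (Real.exp (p * K) - 1) :=
      le_mul_of_one_le_left hexp hL1
    have h₄ : L * (D / K) ≤ L * J := mul_le_mul_of_nonneg_left hDJ (by linarith)
    linarith
end

section
/- Let p > 0, λ ∈ (0,1] and k > 0. For each x > 0 let v(x) ∈ (0, λ) be the unique solution of exp(p·(λ² + v²)/(λ² − v²))·((1 − v²)/(λ² − v²))²·v = k/x². Then x ↦ v(x) is strictly decreasing on (0,∞) and x ↦ x²·v(x) is strictly increasing on (0,∞). -/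
/-- The factor multiplying `v` in the equation defining `v`. -/
noncomputable def distortionFactor (p lam a : ℝ) : ℝ :=
  Real.exp (p * (lam ^ 2 + a ^ 2) / (lam ^ 2 - a ^ 2)) *
    ((1 - a ^ 2) / (lam ^ 2 - a ^ 2)) ^ 2

theorem distortionFactor_pos {p lam a : ℝ} (hlam : lam ≤ 1) (ha : a ∈ Set.Ioo 0 lam) :
    0 < distortionFactor p lam a := by
  obtain ⟨h0, h1⟩ := ha
  have hden : 0 < lam ^ 2 - a ^ 2 := by nlinarith
  have hnum : 0 < 1 - a ^ 2 := by nlinarith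
  unfold distortionFactor
  positivity

theorem strictMonoOn_distortionFactor {p lam : ℝ} (hp : 0 < p) (hlam : lam ≤ 1) :
    StrictMonoOn (distortionFactor p lam) (Set.Ioo 0 lam) := by
  rintro a ⟨ha0, ha1⟩ b ⟨hb0, hb1⟩ hab
  have hda : 0 < lam ^ 2 - a ^ 2 := by nlinarith
  have hdb : 0 < lam ^ 2 - b ^ 2 := by nlinarith
  have hna : 0 < 1 - a ^ 2 := by nlinarith
  have hsq : a ^ 2 < b ^ 2 := by gcongr
  have hlam2 : lam ^ 2 ≤ 1 := by nlinarith
  have hexp : p * (lam ^ 2 + a ^ 2) / (lam ^ 2 - a ^ 2) <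
      p * (lam ^ 2 + b ^ 2) / (lam ^ 2 - b ^ 2) := by gcongr
  have hratio : (1 - a ^ 2) / (lam ^ 2 - a ^ 2) ≤ (1 - b ^ 2) / (lam ^ 2 - b ^ 2) := by
    rw [div_le_div_iff₀ hda hdb]
    nlinarith [mul_nonneg (sub_nonneg.2 hlam2) (sub_nonneg.2 hsq.le)]
  unfold distortionFactor
  exact mul_lt_mul (Real.exp_lt_exp.2 hexp) (by gcongr) (by positivity) (by positivity)

/-- For p > 0, λ ∈ (0,1], k > 0, if v(x) ∈ (0, λ) is, for each x > 0, the solution of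
exp(p(λ² + v²)/(λ² − v²))·((1 − v²)/(λ² − v²))²·v = k/x², then v is strictly
decreasing and x ↦ x²·v(x) is strictly increasing on (0,∞). -/
theorem stmt8 (p lam k : ℝ) (hp : 0 < p) (hlam : lam ∈ Set.Ioc (0 : ℝ) 1) (hk : 0 < k)
    (v : ℝ → ℝ)
    (hv : ∀ x : ℝ, 0 < x → v x ∈ Set.Ioo 0 lam ∧
      Real.exp (p * (lam ^ 2 + (v x) ^ 2) / (lam ^ 2 - (v x) ^ 2)) *
        ((1 - (v x) ^ 2) / (lam ^ 2 - (v x) ^ 2)) ^ 2 * v x = k / x ^ 2) :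
    StrictAntiOn v (Set.Ioi 0) ∧ StrictMonoOn (fun x => x ^ 2 * v x) (Set.Ioi 0) := by
  have heq : ∀ x, 0 < x → distortionFactor p lam (v x) * v x = k / x ^ 2 := fun x hx => (hv x hx).2
  have hmono := strictMonoOn_distortionFactor hp hlam.2
  have hpos : ∀ x, 0 < x → 0 < distortionFactor p lam (v x) := fun x hx =>
    distortionFactor_pos hlam.2 (hv x hx).1
  have hanti : StrictAntiOn v (Set.Ioi 0) := by
    intro s (hs : 0 < s) t (ht : 0 < t) hst
    by_contra! hle
    have hlt : k / t ^ 2 < k / s ^ 2 := by gcongr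
    rw [← heq s hs, ← heq t ht] at hlt
    exact hlt.not_ge (mul_le_mul (hmono.monotoneOn (hv s hs).1 (hv t ht).1 hle) hle
      (hv s hs).1.1.le (hpos t ht).le)
  refine ⟨hanti, ?_⟩
  have hw : ∀ x, 0 < x → x ^ 2 * v x = k / distortionFactor p lam (v x) := by
    intro x hx
    have h := heq x hx
    rw [eq_div_iff (by positivity)] at h
    rw [eq_div_iff (hpos x hx).ne']
    linarith
  intro s (hs : 0 < s) t (ht : 0 < t) hst
  change s ^ 2 * v s < t ^ 2 * v t
  rw [hw s hs, hw t ht]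
  exact div_lt_div_of_pos_left hk (hpos t ht) (hmono (hv t ht).1 (hv s hs).1 (hanti hs ht hst))
end

section
/- Let λ ∈ (0,1], t₀ > 0, and let v : (0,∞) → [0,λ] be a nonincreasing function. Then for all s > 0 and all t ≥ t₀, (v(t)·t + v(s)·s)/(t + s) ≤ (λ + v(t₀))/2 ≤ (1 + v(t₀))/2. -/
/-- Refined averaged bound: if v : (0,∞) → [0,λ] is nonincreasing and t₀ > 0, then for
all s > 0 and t ≥ t₀, (v(t)t + v(s)s)/(t + s) ≤ (λ + v(t₀))/2 ≤ (1 + v(t₀))/2. -/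
theorem stmt10 (lam t₀ : ℝ) (hlam : lam ∈ Set.Ioc (0 : ℝ) 1) (ht₀ : 0 < t₀)
    (v : ℝ → ℝ) (hv_anti : AntitoneOn v (Set.Ioi 0))
    (hv_range : ∀ x : ℝ, 0 < x → v x ∈ Set.Icc 0 lam) :
    ∀ s t : ℝ, 0 < s → t₀ ≤ t →
      (v t * t + v s * s) / (t + s) ≤ (lam + v t₀) / 2 ∧
      (lam + v t₀) / 2 ≤ (1 + v t₀) / 2 := by
  intro s t hs ht
  have ht_pos : 0 < t := ht₀.trans_le ht
  have hvt : v t ≤ v t₀ := hv_anti ht₀ ht_pos ht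
  have hv₀ : v t₀ ≤ lam := (hv_range t₀ ht₀).2
  refine ⟨?_, by linarith [hlam.2]⟩
  rw [div_le_iff₀ (add_pos ht_pos hs)]
  have ht_mul : v t * t ≤ v t₀ * t := mul_le_mul_of_nonneg_right hvt ht_pos.le
  rcases le_total s t with hst | hts
  · have hs_mul : v s * s ≤ lam * s := mul_le_mul_of_nonneg_right (hv_range s hs).2 hs.le
    linarith [mul_nonneg (sub_nonneg.2 hv₀) (sub_nonneg.2 hst)]
  · have hs_mul : v s * s ≤ v t₀ * s :=
      mul_le_mul_of_nonneg_right (hv_anti ht₀ hs (ht.trans hts)) hs.le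
    linarith [mul_nonneg (sub_nonneg.2 hv₀) (add_pos ht_pos hs).le]
end

section
/- Let p > 0 and 0 ≤ t < 1. Then 1 + (4p + 2)t² − 3t⁴ > 0 and 1 ≤ (3 + (4p − 2)t² − t⁴)/(1 + (4p + 2)t² − 3t⁴) ≤ 3. -/
/-- For p > 0 and 0 ≤ t < 1: 1 + (4p + 2)t² − 3t⁴ > 0 and
1 ≤ (3 + (4p − 2)t² − t⁴)/(1 + (4p + 2)t² − 3t⁴) ≤ 3. -/
theorem stmt13 (p t : ℝ) (hp : 0 < p) (ht0 : 0 ≤ t) (ht1 : t < 1) :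
    0 < 1 + (4 * p + 2) * t ^ 2 - 3 * t ^ 4 ∧
    1 ≤ (3 + (4 * p - 2) * t ^ 2 - t ^ 4) / (1 + (4 * p + 2) * t ^ 2 - 3 * t ^ 4) ∧
    (3 + (4 * p - 2) * t ^ 2 - t ^ 4) / (1 + (4 * p + 2) * t ^ 2 - 3 * t ^ 4) ≤ 3 := by
  have hs0 : 0 ≤ t ^ 2 := sq_nonneg t
  have hs1 : 0 < 1 - t ^ 2 := by nlinarith
  have hps : 0 ≤ p * t ^ 2 := by positivity
  have hD : 0 < 1 + (4 * p + 2) * t ^ 2 - 3 * t ^ 4 := by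
    have h : 0 < (1 - t ^ 2) * (1 + 3 * t ^ 2) := by positivity
    linarith
  refine ⟨hD, ?_, ?_⟩
  · rw [le_div_iff₀ hD]
    linarith [sq_nonneg (1 - t ^ 2)]
  · rw [div_le_iff₀ hD]
    linarith [mul_nonneg hs0 hs1.le]
end

section
/- Let p > 0 and x > 0. For each k ≥ 0 let y(k) ∈ [0, x) denote the unique solution of exp(p·(x² + y²)/(x² − y²))·y·x = k. Then k ↦ y(k) is nondecreasing and for all 0 ≤ k₁ ≤ k₂ one has 0 ≤ y(k₂) − y(k₁) ≤ (k₂ − k₁)/x. -/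
/-- The map `b ↦ exp(p(x² + b²)/(x² − b²))·b·x` expands distances on `[0, x)` by at least `x`. -/
theorem sub_mul_le_exp_mul_sub_exp_mul {p x a b : ℝ} (hp : 0 ≤ p) (ha : 0 ≤ a) (hab : a ≤ b)
    (hbx : b < x) :
    (b - a) * x ≤ Real.exp (p * (x ^ 2 + b ^ 2) / (x ^ 2 - b ^ 2)) * b * x -
      Real.exp (p * (x ^ 2 + a ^ 2) / (x ^ 2 - a ^ 2)) * a * x := by
  have hb : 0 ≤ b := ha.trans hab
  have hx : 0 ≤ x := hb.trans hbx.le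
  have hsq : a ^ 2 ≤ b ^ 2 := by gcongr
  have hdb : 0 < x ^ 2 - b ^ 2 := sub_pos.2 (by gcongr)
  have hmono : Real.exp (p * (x ^ 2 + a ^ 2) / (x ^ 2 - a ^ 2)) ≤
      Real.exp (p * (x ^ 2 + b ^ 2) / (x ^ 2 - b ^ 2)) := by gcongr
  have hone : 1 ≤ Real.exp (p * (x ^ 2 + a ^ 2) / (x ^ 2 - a ^ 2)) :=
    Real.one_le_exp (div_nonneg (by positivity) (by linarith))
  rw [← sub_mul]
  refine mul_le_mul_of_nonneg_right ?_ hx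
  nlinarith [mul_nonneg (sub_nonneg.2 hmono) hb, mul_nonneg (sub_nonneg.2 hone) (sub_nonneg.2 hab)]

/-- Lipschitz dependence on the parameter k: if for each k ≥ 0, y(k) ∈ [0, x) solves
exp(p(x² + y²)/(x² − y²))·y·x = k, then k ↦ y(k) is nondecreasing on [0,∞) and
0 ≤ y(k₂) − y(k₁) ≤ (k₂ − k₁)/x for 0 ≤ k₁ ≤ k₂. -/
theorem stmt15 (p x : ℝ) (hp : 0 < p) (hx : 0 < x) (y : ℝ → ℝ)
    (hy : ∀ k : ℝ, 0 ≤ k → y k ∈ Set.Ico 0 x ∧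
      Real.exp (p * (x ^ 2 + (y k) ^ 2) / (x ^ 2 - (y k) ^ 2)) * y k * x = k) :
    MonotoneOn y (Set.Ici 0) ∧
    ∀ k₁ k₂ : ℝ, 0 ≤ k₁ → k₁ ≤ k₂ →
      0 ≤ y k₂ - y k₁ ∧ y k₂ - y k₁ ≤ (k₂ - k₁) / x := by
  have hmono : MonotoneOn y (Set.Ici 0) := by
    intro k₁ h₁ k₂ h₂ hk
    obtain ⟨⟨_, hlt₁⟩, he₁⟩ := hy k₁ h₁
    obtain ⟨⟨hnn₂, _⟩, he₂⟩ := hy k₂ h₂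
    by_contra! hlt
    have h := sub_mul_le_exp_mul_sub_exp_mul hp.le hnn₂ hlt.le hlt₁
    rw [he₁, he₂] at h
    linarith [mul_pos (sub_pos.2 hlt) hx]
  refine ⟨hmono, fun k₁ k₂ h₁ hk => ?_⟩
  have h₂ : 0 ≤ k₂ := h₁.trans hk
  have hle : y k₁ ≤ y k₂ := hmono h₁ h₂ hk
  have h := sub_mul_le_exp_mul_sub_exp_mul hp.le (hy k₁ h₁).1.1 hle (hy k₂ h₂).1.2
  rw [(hy k₁ h₁).2, (hy k₂ h₂).2] at h
  exact ⟨sub_nonneg.2 hle, (le_div_iff₀ hx).2 h⟩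
end

section
/- Let p > 0 and for t ∈ [0,1) set A(t) = t·(1 + (2p + 1)t − t² − t³)/(1 + t + (2p − 1)t² − t³). Then 0 ≤ A(t) < 1, with 1 − A(t) = (1 − t²)²/(1 + t + (2p − 1)t² − t³), and moreover (1 + A(t)²)/(1 − A(t)²) ≤ (1 + t + (2p − 1)t² − t³)/(1 − t²)² ≤ (2p + 2)·((1 + t²)/(1 − t²))². -/
/-- For p > 0 and t ∈ [0,1), with A(t) = t(1 + (2p + 1)t − t² − t³)/(1 + t + (2p − 1)t² − t³):
0 ≤ A < 1, 1 − A = (1 − t²)²/(1 + t + (2p − 1)t² − t³), and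
(1 + A²)/(1 − A²) ≤ (1 + t + (2p − 1)t² − t³)/(1 − t²)² ≤ (2p + 2)((1 + t²)/(1 − t²))². -/
theorem stmt16 (p t : ℝ) (hp : 0 < p) (ht : t ∈ Set.Ico (0 : ℝ) 1) (A : ℝ)
    (hA : A = t * (1 + (2 * p + 1) * t - t ^ 2 - t ^ 3) /
      (1 + t + (2 * p - 1) * t ^ 2 - t ^ 3)) :
    0 ≤ A ∧ A < 1 ∧
    1 - A = (1 - t ^ 2) ^ 2 / (1 + t + (2 * p - 1) * t ^ 2 - t ^ 3) ∧
    (1 + A ^ 2) / (1 - A ^ 2) ≤ (1 + t + (2 * p - 1) * t ^ 2 - t ^ 3) / (1 - t ^ 2) ^ 2 ∧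
    (1 + t + (2 * p - 1) * t ^ 2 - t ^ 3) / (1 - t ^ 2) ^ 2 ≤
      (2 * p + 2) * ((1 + t ^ 2) / (1 - t ^ 2)) ^ 2 := by
  obtain ⟨h0, h1⟩ := ht
  have hs : 0 < 1 - t ^ 2 := by nlinarith
  have hprod : 0 < (1 + t) * (1 - t ^ 2) := by positivity
  have hD : 0 < 1 + t + (2 * p - 1) * t ^ 2 - t ^ 3 := by
    have : 0 ≤ 2 * p * t ^ 2 := by positivity
    linarith
  have hN : 0 ≤ 1 + (2 * p + 1) * t - t ^ 2 - t ^ 3 := by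
    have : 0 ≤ 2 * p * t := by positivity
    linarith
  have hA0 : 0 ≤ A := hA ▸ div_nonneg (mul_nonneg h0 hN) hD.le
  have hsub : 1 - A = (1 - t ^ 2) ^ 2 / (1 + t + (2 * p - 1) * t ^ 2 - t ^ 3) := by
    rw [hA, eq_div_iff hD.ne', sub_mul, div_mul_cancel₀ _ hD.ne']
    ring
  have hpos : 0 < 1 - A := hsub ▸ div_pos (pow_pos hs 2) hD
  refine ⟨hA0, by linarith, hsub, ?_, ?_⟩
  · rw [← inv_div ((1 - t ^ 2) ^ 2), ← hsub, inv_eq_one_div, div_le_div_iff₀ (by nlinarith) hpos]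
    nlinarith [mul_nonneg (mul_nonneg hA0 hpos.le) hpos.le]
  · rw [div_pow, ← mul_div_assoc]
    refine div_le_div_of_nonneg_right ?_ (sq_nonneg _)
    have h3 : 0 ≤ t ^ 3 := by positivity
    have h4 : 0 ≤ (2 * p + 2) * t ^ 4 := by positivity
    have h5 : 0 ≤ p * t ^ 2 := by positivity
    linarith [sq_nonneg t]
end

section
/- There exists a constant c > 0 such that for all real p ≥ 1 and all ν ∈ [0,1], one has 4pν² + (1 − ν + 2ν²)(1 − ν²) > 0 and ν(1 + ν)(1 − ν²)/(4pν² + (1 − ν + 2ν²)(1 − ν²)) ≤ c/√p. -/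
/-- Decay estimate for the p → ∞ regime: there is a constant c > 0 such that for all
p ≥ 1 and ν ∈ [0,1], the quantity 4pν² + (1 − ν + 2ν²)(1 − ν²) is positive and
ν(1 + ν)(1 − ν²)/(4pν² + (1 − ν + 2ν²)(1 − ν²)) ≤ c/√p. -/
theorem stmt17 : ∃ c : ℝ, 0 < c ∧ ∀ p : ℝ, 1 ≤ p → ∀ ν : ℝ, ν ∈ Set.Icc (0 : ℝ) 1 →
    0 < 4 * p * ν ^ 2 + (1 - ν + 2 * ν ^ 2) * (1 - ν ^ 2) ∧
    ν * (1 + ν) * (1 - ν ^ 2) / (4 * p * ν ^ 2 + (1 - ν + 2 * ν ^ 2) * (1 - ν ^ 2)) ≤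
      c / Real.sqrt p := by
  refine ⟨1, one_pos, fun p hp ν ⟨h0, h1⟩ => ?_⟩
  have hs : 1 ≤ √p := Real.one_le_sqrt.mpr hp
  have hsq : √p ^ 2 = p := Real.sq_sqrt (by linarith)
  have hw0 : 0 ≤ 1 - ν ^ 2 := by nlinarith
  have hw1 : 1 - ν ^ 2 ≤ 1 := by nlinarith
  have hK : 7 / 8 ≤ 1 - ν + 2 * ν ^ 2 := by nlinarith [sq_nonneg (4 * ν - 1)]
  have hKw : 7 / 8 * (1 - ν ^ 2) ≤ (1 - ν + 2 * ν ^ 2) * (1 - ν ^ 2) :=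
    mul_le_mul_of_nonneg_right hK hw0
  have hpos : 0 < 4 * p * ν ^ 2 + (1 - ν + 2 * ν ^ 2) * (1 - ν ^ 2) := by
    nlinarith [mul_nonneg (sub_nonneg.mpr hp) (sq_nonneg ν)]
  refine ⟨hpos, ?_⟩
  rw [div_le_div_iff₀ hpos (by linarith), one_mul]
  have hw2 : (1 - ν ^ 2) ^ 2 ≤ 1 - ν ^ 2 := by nlinarith
  have hnum : ν * (1 + ν) * (1 - ν ^ 2) * √p ≤ 2 * (√p * ν) * (1 - ν ^ 2) := by
    have : 0 ≤ √p * ν * (1 - ν ^ 2) * (1 - ν) := by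
      have : 0 ≤ 1 - ν := by linarith
      positivity
    linarith
  have hp4 : 4 * p * ν ^ 2 = 4 * (√p * ν) ^ 2 := by rw [mul_pow, hsq]; ring
  rw [hp4]
  linarith [sq_nonneg (2 * (√p * ν) - (1 - ν ^ 2) / 2), sq_nonneg (1 - ν ^ 2)]
end

section
/- Let p > 0 and let λ, v be real numbers with 0 < v < λ ≤ 1. Then 4pλ²v/(λ² − v²)² + 4v(1 − λ²)/((λ² − v²)(1 − v²)) + 1/v ≥ min{pλ², 4λ²}. -/
/-- For p > 0 and 0 < v < λ ≤ 1:
4pλ²v/(λ² − v²)² + 4v(1 − λ²)/((λ² − v²)(1 − v²)) + 1/v ≥ min{pλ², 4λ²}. -/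
theorem stmt18 (p lam v : ℝ) (hp : 0 < p) (hv : 0 < v) (hvlam : v < lam) (hlam : lam ≤ 1) :
    min (p * lam ^ 2) (4 * lam ^ 2) ≤
      4 * p * lam ^ 2 * v / (lam ^ 2 - v ^ 2) ^ 2 +
        4 * v * (1 - lam ^ 2) / ((lam ^ 2 - v ^ 2) * (1 - v ^ 2)) + 1 / v := by
  have hd : 0 < lam ^ 2 - v ^ 2 := by nlinarith
  have hl : lam ^ 2 ≤ 1 := by nlinarith
  have hw : 0 < 1 - v ^ 2 := by nlinarith
  have hA : 0 ≤ 4 * p * lam ^ 2 * v / (lam ^ 2 - v ^ 2) ^ 2 := by positivity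
  have hB : 0 ≤ 4 * v * (1 - lam ^ 2) / ((lam ^ 2 - v ^ 2) * (1 - v ^ 2)) :=
    div_nonneg (mul_nonneg (by positivity) (by linarith)) (by positivity)
  have hC : 0 < 1 / v := by positivity
  rcases le_total 1 (4 * v) with h | h
  · have hd1 : (lam ^ 2 - v ^ 2) ^ 2 ≤ 1 := by nlinarith [sq_nonneg v]
    have hA' : p * lam ^ 2 ≤ 4 * p * lam ^ 2 * v / (lam ^ 2 - v ^ 2) ^ 2 := by
      rw [le_div_iff₀ (by positivity)]
      calc p * lam ^ 2 * (lam ^ 2 - v ^ 2) ^ 2 ≤ p * lam ^ 2 * (4 * v) :=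
            mul_le_mul_of_nonneg_left (hd1.trans h) (by positivity)
        _ = 4 * p * lam ^ 2 * v := by ring
    linarith [min_le_left (p * lam ^ 2) (4 * lam ^ 2)]
  · have hC' : 4 ≤ 1 / v := by
      rw [le_div_iff₀ hv]
      exact h
    linarith [min_le_right (p * lam ^ 2) (4 * lam ^ 2)]
end
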